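/- arXiv:2011.02960 — 12 statements merged into one kernel-verified Lean document; each statement's English description precedes it below -/
import Mathlib

section
/- Let 0<q<1, a<b be real numbers, and f:[a,b]→ℝ an arbitrary function. Then for all m,k∈ℕ∪{0}, |f(a + q^m(b−a)) − f(a + q^k(b−a))| ≤ (b−a)·|q^m − q^k| · ‖D_q^a f‖_∞^{(a,b]}. -/
open Set

/-- Shifted q-derivative of `f` (with base point `a`). -/
noncomputable def qDeriv (q a : ℝ) (f : ℝ → ℝ) (x : ℝ) : ℝ :=
  (f x - f (a + q * (x - a))) / ((1 - q) * (x - a))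

/-- Shifted q-integral of `f` over `[a,b]`. -/
noncomputable def qIntegral (q a b : ℝ) (f : ℝ → ℝ) : ℝ :=
  (1 - q) * (b - a) * ∑' k : ℕ, q ^ k * f (a + q ^ k * (b - a))

/-- `f` is q-integrable over `[a,b]`. -/
def qIntegrable (q a b : ℝ) (f : ℝ → ℝ) : Prop :=
  Summable fun k : ℕ => q ^ k * f (a + q ^ k * (b - a))

theorem abs_sub_le_of_abs_qDeriv_le {q a x M : ℝ} {f : ℝ → ℝ} (hq1 : q < 1) (hx : a < x)
    (h : |qDeriv q a f x| ≤ M) :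
    |f x - f (a + q * (x - a))| ≤ (1 - q) * (x - a) * M := by
  have hpos : 0 < (1 - q) * (x - a) := mul_pos (sub_pos.2 hq1) (sub_pos.2 hx)
  rwa [qDeriv, abs_div, abs_of_pos hpos, div_le_iff₀' hpos] at h

/-- The mean value inequality between two ordered points of the q-lattice. -/
theorem abs_sub_le_of_abs_qDeriv_le_of_le {q a b M : ℝ} {f : ℝ → ℝ} (hq : 0 < q) (hq1 : q < 1)
    (hab : a < b) (hM : ∀ t ∈ Set.Ioc a b, |qDeriv q a f t| ≤ M) {m k : ℕ} (hmk : m ≤ k) :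
    |f (a + q ^ m * (b - a)) - f (a + q ^ k * (b - a))| ≤ (b - a) * (q ^ m - q ^ k) * M := by
  induction k, hmk using Nat.le_induction with
  | base => simp
  | succ k _ ih =>
    have hc : 0 < b - a := sub_pos.2 hab
    have hlt : a < a + q ^ k * (b - a) := lt_add_of_pos_right a (mul_pos (pow_pos hq k) hc)
    have hle : a + q ^ k * (b - a) ≤ b := by
      have := mul_le_of_le_one_left hc.le (pow_le_one₀ hq.le hq1.le (n := k))
      linarith
    have hstep := abs_sub_le_of_abs_qDeriv_le hq1 hlt (hM _ ⟨hlt, hle⟩)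
    rw [add_sub_cancel_left, ← mul_assoc q, ← pow_succ'] at hstep
    calc _ ≤ _ := abs_sub_le _ (f (a + q ^ k * (b - a))) _
      _ ≤ _ := add_le_add ih hstep
      _ = _ := by ring

/-- mean value inequality on the q-lattice. -/
theorem stmt_2 (q a b : ℝ) (hq : 0 < q) (hq1 : q < 1) (hab : a < b)
    (f : ℝ → ℝ) (m k : ℕ)
    (M : ℝ) (hM : ∀ t ∈ Set.Ioc a b, |qDeriv q a f t| ≤ M) :
    |f (a + q ^ m * (b - a)) - f (a + q ^ k * (b - a))| ≤
      (b - a) * |q ^ m - q ^ k| * M := by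
  have hanti : Antitone fun n : ℕ => q ^ n := pow_right_anti₀ hq.le hq1.le
  rcases le_total m k with h | h
  · rw [abs_of_nonneg (sub_nonneg.2 (hanti h))]
    exact abs_sub_le_of_abs_qDeriv_le_of_le hq hq1 hab hM h
  · rw [abs_sub_comm, abs_sub_comm (q ^ m), abs_of_nonneg (sub_nonneg.2 (hanti h))]
    exact abs_sub_le_of_abs_qDeriv_le_of_le hq hq1 hab hM h
end

section
/- (Lagrange's mean value theorem for q-calculus) Let 0<q<1, a<b be real numbers, f:[a,b]→ℝ a continuous function, and let x,y∈(a,b] be such that y = a + qⁿ(x−a) for some n∈ℕ∪{0}. Then there exists c∈[y,x] such that f(x) − f(y) = D_q^a f(c)·(x−y). -/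
open Set

theorem sub_eq_qDeriv_mul {q a t : ℝ} (hq1 : q < 1) (ht : a < t) (f : ℝ → ℝ) :
    f t - f (a + q * (t - a)) = qDeriv q a f t * (t - (a + q * (t - a))) := by
  have h1 : (1 - q) ≠ 0 := (sub_pos.2 hq1).ne'
  have h2 : t - a ≠ 0 := (sub_pos.2 ht).ne'
  unfold qDeriv
  field_simp
  ring

theorem sub_mem_Icc_of_qDeriv_mem_Icc {q a x m M : ℝ} (hq : 0 < q) (hq1 : q < 1) (hx : a < x)
    (f : ℝ → ℝ) (n : ℕ)
    (h : ∀ c ∈ Set.Icc (a + q ^ n * (x - a)) x, qDeriv q a f c ∈ Set.Icc m M) :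
    f x - f (a + q ^ n * (x - a)) ∈
      Set.Icc (m * (x - (a + q ^ n * (x - a)))) (M * (x - (a + q ^ n * (x - a)))) := by
  have hxa : 0 < x - a := sub_pos.2 hx
  induction n with
  | zero => simp
  | succ n ih =>
    set t := a + q ^ n * (x - a) with ht
    have hat : a < t := by rw [ht]; linarith [mul_pos (pow_pos hq n) hxa]
    have hnext : a + q ^ (n + 1) * (x - a) = a + q * (t - a) := by rw [ht]; ring
    have htx : t ≤ x := by
      have := mul_le_mul_of_nonneg_right (pow_le_one₀ (n := n) hq.le hq1.le) hxa.le
      linarith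
    rw [hnext] at h ⊢
    have hlt : a + q * (t - a) ≤ t := by nlinarith
    obtain ⟨h1, h2⟩ := ih fun c hc => h c ⟨hlt.trans hc.1, hc.2⟩
    obtain ⟨h3, h4⟩ := h t ⟨hlt, htx⟩
    have hstep := sub_eq_qDeriv_mul hq1 hat f
    have h5 := mul_le_mul_of_nonneg_right h3 (sub_nonneg.2 hlt)
    have h6 := mul_le_mul_of_nonneg_right h4 (sub_nonneg.2 hlt)
    constructor <;> linarith

theorem continuousOn_qDeriv {q a b : ℝ} (hq : 0 < q) (hq1 : q < 1) {f : ℝ → ℝ}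
    (hf : ContinuousOn f (Set.Icc a b)) : ContinuousOn (qDeriv q a f) (Set.Ioc a b) := by
  refine ContinuousOn.div (f := fun t => f t - f (a + q * (t - a)))
    (g := fun t => (1 - q) * (t - a)) ((hf.mono Set.Ioc_subset_Icc_self).sub
    (hf.comp (by fun_prop) fun t ht => ?_)) (by fun_prop) fun t ht => ?_
  · have hta : 0 < t - a := sub_pos.2 ht.1
    constructor
    · nlinarith
    · nlinarith [ht.2]
  · exact (mul_pos (sub_pos.2 hq1) (sub_pos.2 ht.1)).ne'

/-- Lagrange's mean value theorem for q-calculus. -/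
theorem stmt_3 (q a b : ℝ) (hq : 0 < q) (hq1 : q < 1) (hab : a < b)
    (f : ℝ → ℝ) (hf : ContinuousOn f (Set.Icc a b))
    (x y : ℝ) (hx : x ∈ Set.Ioc a b) (hy : y ∈ Set.Ioc a b)
    (n : ℕ) (hxy : y = a + q ^ n * (x - a)) :
    ∃ c ∈ Set.Icc y x, f x - f y = qDeriv q a f c * (x - y) := by
  have hyx : y ≤ x := by
    have := mul_le_mul_of_nonneg_right (pow_le_one₀ (n := n) hq.le hq1.le) (sub_pos.2 hx.1).le
    linarith
  have hcont : ContinuousOn (qDeriv q a f) (Set.Icc y x) :=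
    (continuousOn_qDeriv hq hq1 hf).mono fun t ht => ⟨hy.1.trans_le ht.1, ht.2.trans hx.2⟩
  have hne : (Set.Icc y x).Nonempty := Set.nonempty_Icc.2 hyx
  obtain ⟨u, hu, hmin⟩ := isCompact_Icc.exists_isMinOn hne hcont
  obtain ⟨v, hv, hmax⟩ := isCompact_Icc.exists_isMaxOn hne hcont
  have hmem := sub_mem_Icc_of_qDeriv_mem_Icc (m := qDeriv q a f u) (M := qDeriv q a f v)
    hq hq1 hx.1 f n (by rw [← hxy]; exact fun c hc => ⟨hmin hc, hmax hc⟩)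
  rw [← hxy] at hmem
  obtain ⟨c, hc, hfc⟩ := isPreconnected_Icc.intermediate_value hu hv
    (hcont.mul (continuousOn_const (c := x - y))) hmem
  exact ⟨c, hc, hfc.symm⟩
end

section
/- For every 0<q<1 and every m∈ℕ∪{0}, the series Σ_{k=0}^∞ q^k·|q^m − q^k| converges and equals (1/(1−q))·((1 + 2q^{2m+1})/(1+q) − q^m). -/
open Set

/-- the value of the series `Σ qᵏ·|qᵐ − qᵏ|`. -/
theorem stmt_4 (q : ℝ) (hq : 0 < q) (hq1 : q < 1) (m : ℕ) :
    HasSum (fun k : ℕ => q ^ k * |q ^ m - q ^ k|)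
      ((1 / (1 - q)) * ((1 + 2 * q ^ (2 * m + 1)) / (1 + q) - q ^ m)) := by
  have h₁ : 1 - q ≠ 0 := by linarith
  have h₂ : 1 + q ≠ 0 := by linarith
  have habs (n : ℕ) : |1 - q ^ n| = 1 - q ^ n :=
    abs_of_nonneg (sub_nonneg.2 (pow_le_one₀ hq.le hq1.le))
  induction m with
  | zero =>
    have h := (hasSum_geometric_of_lt_one hq.le hq1).sub
      (hasSum_geometric_of_lt_one (sq_nonneg q) (pow_lt_one₀ hq.le hq1 two_ne_zero))
    have hterm (k : ℕ) : q ^ k * |q ^ 0 - q ^ k| = q ^ k - (q ^ 2) ^ k := by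
      rw [pow_zero, habs]
      ring
    rw [funext hterm]
    convert h using 1
    · rfl
    rw [show 1 - q ^ 2 = (1 - q) * (1 + q) by ring]
    field_simp
    ring
  | succ m ih =>
    have hterm (k : ℕ) : q ^ (k + 1) * |q ^ (m + 1) - q ^ (k + 1)|
        = q ^ 2 * (q ^ k * |q ^ m - q ^ k|) := by
      rw [show q ^ (m + 1) - q ^ (k + 1) = q * (q ^ m - q ^ k) by ring, abs_mul, abs_of_pos hq]
      ring
    rw [← hasSum_nat_add_iff' 1, funext hterm, Finset.sum_range_one, pow_zero, one_mul,
      abs_sub_comm, habs]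
    convert ih.mul_left (q ^ 2) using 1
    · rfl
    field_simp
    ring
end

section
/- (q-Ostrowski inequality on the q-lattice) Let 0<q<1, a<b be real numbers, and f:[a,b]→ℝ a q-integrable function over [a,b]. Then for every m∈ℕ∪{0}, |f(a + q^m(b−a)) − (1/(b−a))·∫_a^b f(t) d_q^a t| ≤ (b−a)·((1 + 2q^{2m+1})/(1+q) − q^m)·‖D_q^a f‖_∞^{(a,b]}. -/
open Set

/-- A sequence whose consecutive increments are bounded by those of `C * q ^ k` is Lipschitz
with constant `C` with respect to the geometric sequence. -/
lemma abs_sub_le_mul_abs_pow_sub_pow {q C : ℝ} (hq : 0 ≤ q) (hq1 : q ≤ 1) {g : ℕ → ℝ}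
    (hg : ∀ k, |g k - g (k + 1)| ≤ C * (q ^ k - q ^ (k + 1))) (i j : ℕ) :
    |g i - g j| ≤ C * |q ^ i - q ^ j| := by
  have key : ∀ i n, |g i - g (i + n)| ≤ C * (q ^ i - q ^ (i + n)) := by
    intro i n
    induction n with
    | zero => simp
    | succ n ih =>
      calc |g i - g (i + (n + 1))| ≤ |g i - g (i + n)| + |g (i + n) - g (i + n + 1)| :=
            abs_sub_le _ _ _
        _ ≤ C * (q ^ i - q ^ (i + n)) + C * (q ^ (i + n) - q ^ (i + n + 1)) :=
            add_le_add ih (hg _)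
        _ = C * (q ^ i - q ^ (i + (n + 1))) := by ring
  rcases le_total i j with h | h
  · obtain ⟨n, rfl⟩ := Nat.exists_eq_add_of_le h
    rw [abs_of_nonneg (sub_nonneg.2 (pow_le_pow_of_le_one hq hq1 h))]
    exact key i n
  · obtain ⟨n, rfl⟩ := Nat.exists_eq_add_of_le h
    rw [abs_sub_comm, abs_sub_comm (q ^ (j + n)),
      abs_of_nonneg (sub_nonneg.2 (pow_le_pow_of_le_one hq hq1 h))]
    exact key j n

lemma sum_range_pow_mul_pow_sub {q : ℝ} (hq : 0 ≤ q) (c : ℝ) (m : ℕ) :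
    (1 - q) * ∑ k ∈ Finset.range m, q ^ k * (q ^ k - c) =
      (1 - q ^ (2 * m)) / (1 + q) - c * (1 - q ^ m) := by
  have h : 1 + q ≠ 0 := by positivity
  induction m with
  | zero => simp
  | succ m ih =>
    rw [Finset.sum_range_succ, mul_add, ih]
    field_simp
    ring

/-- The mean distance from `q ^ m` to the geometric sequence, with geometric weights. -/
lemma hasSum_pow_mul_abs_pow_sub_pow {q : ℝ} (hq : 0 ≤ q) (hq1 : q < 1) (m : ℕ) :
    HasSum (fun k : ℕ => (1 - q) * (q ^ k * |q ^ m - q ^ k|))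
      ((1 + 2 * q ^ (2 * m + 1)) / (1 + q) - q ^ m) := by
  have hone : 1 - q ≠ 0 := (sub_pos.2 hq1).ne'
  have hadd : 1 + q ≠ 0 := by positivity
  have hgeom := (hasSum_geometric_of_lt_one hq hq1).mul_left ((1 - q) * q ^ m)
  have hgeom2 := (hasSum_geometric_of_lt_one (sq_nonneg q)
    (by nlinarith : q ^ 2 < 1)).mul_left (1 - q)
  have hfin := hasSum_sum_of_ne_finset_zero (L := .unconditional ℕ)
    (f := fun k => if k < m then 2 * (1 - q) * (q ^ k * (q ^ k - q ^ m)) else 0)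
    (s := Finset.range m) (fun k hk => if_neg (by simpa using hk))
  have hval : ∑ k ∈ Finset.range m,
      (if k < m then 2 * (1 - q) * (q ^ k * (q ^ k - q ^ m)) else 0) =
      2 * ((1 - q ^ (2 * m)) / (1 + q) - q ^ m * (1 - q ^ m)) := by
    rw [← sum_range_pow_mul_pow_sub hq, ← mul_assoc, Finset.mul_sum]
    exact Finset.sum_congr rfl fun k hk => if_pos (Finset.mem_range.1 hk)
  rw [hval] at hfin
  convert (hgeom.sub hgeom2).add hfin using 1
  · rfl
  · funext k
    split_ifs with h
    · rw [abs_of_nonpos (sub_nonpos.2 (pow_le_pow_of_le_one hq hq1.le h.le))]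
      ring
    · rw [abs_of_nonneg (sub_nonneg.2 (pow_le_pow_of_le_one hq hq1.le (not_lt.1 h)))]
      ring
  · rw [show 1 - q ^ 2 = (1 - q) * (1 + q) by ring]
    field_simp
    ring

/-- A bound on the shifted q-derivative controls the increments of `f` along the q-lattice. -/
lemma abs_sub_le_of_abs_qDeriv_le_s5 {q a b M : ℝ} (hq : 0 < q) (hq1 : q < 1) (hab : a < b)
    {f : ℝ → ℝ} (hM : ∀ t ∈ Set.Ioc a b, |qDeriv q a f t| ≤ M) (k : ℕ) :
    |f (a + q ^ k * (b - a)) - f (a + q ^ (k + 1) * (b - a))| ≤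
      (b - a) * M * (q ^ k - q ^ (k + 1)) := by
  have hb : 0 < b - a := sub_pos.2 hab
  have hpos : 0 < q ^ k * (b - a) := by positivity
  have hle : q ^ k * (b - a) ≤ b - a :=
    mul_le_of_le_one_left hb.le (pow_le_one₀ hq.le hq1.le)
  have hden : 0 < (1 - q) * (q ^ k * (b - a)) := mul_pos (sub_pos.2 hq1) hpos
  have h := hM (a + q ^ k * (b - a)) ⟨by linarith, by linarith⟩
  rw [qDeriv, add_sub_cancel_left, abs_div, abs_of_pos hden, div_le_iff₀ hden,
    show q * (q ^ k * (b - a)) = q ^ (k + 1) * (b - a) by ring] at h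
  exact h.trans_eq (by ring)

/-- q-Ostrowski inequality on the q-lattice. -/
theorem stmt_5 (q a b : ℝ) (hq : 0 < q) (hq1 : q < 1) (hab : a < b)
    (f : ℝ → ℝ) (hf : qIntegrable q a b f) (m : ℕ)
    (M : ℝ) (hM : ∀ t ∈ Set.Ioc a b, |qDeriv q a f t| ≤ M) :
    |f (a + q ^ m * (b - a)) - (1 / (b - a)) * qIntegral q a b f| ≤
      (b - a) * ((1 + 2 * q ^ (2 * m + 1)) / (1 + q) - q ^ m) * M := by
  have hb : b - a ≠ 0 := (sub_pos.2 hab).ne'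
  set g : ℕ → ℝ := fun k => f (a + q ^ k * (b - a))
  have hlip := abs_sub_le_mul_abs_pow_sub_pow (g := g) hq.le hq1.le
    (abs_sub_le_of_abs_qDeriv_le_s5 hq hq1 hab hM)
  have hint : HasSum (fun k => (1 - q) * (q ^ k * g k)) (1 / (b - a) * qIntegral q a b f) := by
    have h : 1 / (b - a) * qIntegral q a b f = (1 - q) * ∑' k : ℕ, q ^ k * g k := by
      rw [qIntegral, ← mul_assoc, mul_left_comm, one_div, inv_mul_cancel₀ hb, mul_one]
    rw [h]
    exact (Summable.hasSum hf).mul_left (1 - q)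
  have hconst : HasSum (fun k => (1 - q) * g m * q ^ k) (g m) := by
    have h := (hasSum_geometric_of_lt_one hq.le hq1).mul_left ((1 - q) * g m)
    rwa [mul_right_comm, mul_inv_cancel₀ (sub_pos.2 hq1).ne', one_mul] at h
  have hdiff := hconst.sub hint
  have hbound := (hasSum_pow_mul_abs_pow_sub_pow hq.le hq1 m).mul_left ((b - a) * M)
  have h := hdiff.norm_le_of_bounded hbound fun k => by
    have hw : 0 ≤ (1 - q) * q ^ k := mul_nonneg (sub_nonneg.2 hq1.le) (by positivity)
    rw [Real.norm_eq_abs,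
      show (1 - q) * g m * q ^ k - (1 - q) * (q ^ k * g k) =
        (1 - q) * q ^ k * (g m - g k) by ring, abs_mul, abs_of_nonneg hw]
    exact (mul_le_mul_of_nonneg_left (hlip m k) hw).trans_eq (by ring)
  exact h.trans_eq (by ring)
end

section
/- For every 0<q<1, every x∈(0,1) that is not of the form qⁿ for any n∈ℕ∪{0}, and every ε>0, there exists a continuous function f:[0,1]→ℝ that is q-integrable over [0,1], such that the limit lim_{t→0+} D_q f(t) exists, sup_{t∈(0,1]} |D_q f(t)| ≤ 1, and |f(x) − ∫_0^1 f(t) d_q t| ≥ x + 1/(1+q) − ε. -/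
open Set

/-- The `q`-antiderivative of `g` vanishing at `0`. -/
noncomputable def qAntideriv (q : ℝ) (g : ℝ → ℝ) (t : ℝ) : ℝ :=
  (1 - q) * t * ∑' k : ℕ, q ^ k * g (q ^ k * t)

section qAntideriv

variable {q : ℝ} {g : ℝ → ℝ}

theorem abs_pow_mul_le_pow (hq : 0 < q) (hg : ∀ t, |g t| ≤ 1) (t : ℝ) (k : ℕ) :
    |q ^ k * g t| ≤ q ^ k := by
  rw [abs_mul, abs_of_pos (pow_pos hq k)]
  exact mul_le_of_le_one_right (pow_pos hq k).le (hg t)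

theorem summable_pow_mul_comp (hq : 0 < q) (hq1 : q < 1) (hg : ∀ t, |g t| ≤ 1) (t : ℝ) :
    Summable fun k : ℕ => q ^ k * g (q ^ k * t) :=
  (summable_geometric_of_lt_one hq.le hq1).of_norm_bounded
    fun k => abs_pow_mul_le_pow hq hg _ k

theorem continuous_qAntideriv (hq : 0 < q) (hq1 : q < 1) (hc : Continuous g)
    (hg : ∀ t, |g t| ≤ 1) : Continuous (qAntideriv q g) := by
  refine (continuous_const.mul continuous_id).mul (continuous_tsum (fun k => ?_)
    (summable_geometric_of_lt_one hq.le hq1) fun k t => abs_pow_mul_le_pow hq hg _ k)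
  fun_prop

theorem qAntideriv_eq_add (hq : 0 < q) (hq1 : q < 1) (hg : ∀ t, |g t| ≤ 1) (t : ℝ) :
    qAntideriv q g t = qAntideriv q g (q * t) + (1 - q) * t * g t := by
  have h : ∑' k : ℕ, q ^ (k + 1) * g (q ^ (k + 1) * t)
      = q * ∑' k : ℕ, q ^ k * g (q ^ k * (q * t)) := by
    rw [← tsum_mul_left]
    refine tsum_congr fun k => ?_
    rw [pow_succ, mul_assoc (q ^ k) q t]
    ring
  unfold qAntideriv
  rw [(summable_pow_mul_comp hq hq1 hg t).tsum_eq_zero_add, h]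
  simp only [pow_zero, one_mul]
  ring

theorem qDeriv_qAntideriv (hq : 0 < q) (hq1 : q < 1) (hg : ∀ t, |g t| ≤ 1) {t : ℝ}
    (ht : t ≠ 0) : qDeriv q 0 (qAntideriv q g) t = g t := by
  have h1 : 1 - q ≠ 0 := (sub_pos.2 hq1).ne'
  rw [qDeriv, sub_zero, zero_add, qAntideriv_eq_add hq hq1 hg t]
  field_simp
  ring

theorem abs_qAntideriv_le (hq : 0 < q) (hq1 : q < 1) (hg : ∀ t, |g t| ≤ 1) (t : ℝ) :
    |qAntideriv q g t| ≤ |t| := by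
  have h1 : 0 < 1 - q := sub_pos.2 hq1
  have h : |∑' k : ℕ, q ^ k * g (q ^ k * t)| ≤ (1 - q)⁻¹ := by
    rw [← Real.norm_eq_abs]
    exact tsum_of_norm_bounded (hasSum_geometric_of_lt_one hq.le hq1)
      fun k => abs_pow_mul_le_pow hq hg _ k
  rw [qAntideriv, abs_mul, abs_mul, abs_of_pos h1]
  calc (1 - q) * |t| * |∑' k : ℕ, q ^ k * g (q ^ k * t)|
      ≤ (1 - q) * |t| * (1 - q)⁻¹ := by gcongr
    _ = |t| := by field_simp

theorem qAntideriv_eq_of_const (hq : 0 < q) (hq1 : q < 1) (hg : ∀ t, |g t| ≤ 1) (c t : ℝ)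
    (N : ℕ) (h : ∀ k < N, g (q ^ k * t) = c) :
    qAntideriv q g t = qAntideriv q g (q ^ N * t) + c * t * (1 - q ^ N) := by
  induction N with
  | zero => simp
  | succ N ih =>
    rw [ih fun k hk => h k (hk.trans N.lt_succ_self), qAntideriv_eq_add hq hq1 hg (q ^ N * t),
      h N N.lt_succ_self, ← mul_assoc q, ← pow_succ']
    ring

theorem le_qAntideriv_of_eq_one (hq : 0 < q) (hq1 : q < 1) (hg : ∀ t, |g t| ≤ 1) {t : ℝ}
    (ht : 0 ≤ t) (N : ℕ) (h : ∀ k < N, g (q ^ k * t) = 1) :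
    t - 2 * (q ^ N * t) ≤ qAntideriv q g t := by
  have h1 := neg_le_of_abs_le (abs_qAntideriv_le hq hq1 hg (q ^ N * t))
  rw [abs_of_nonneg (by positivity)] at h1
  rw [qAntideriv_eq_of_const hq hq1 hg 1 t N h]
  linarith

theorem qAntideriv_pow_le (hq : 0 < q) (hq1 : q < 1) (hg : ∀ t, |g t| ≤ 1) (N : ℕ)
    (h : ∀ k < N, g (q ^ k) = -1) (n : ℕ) :
    qAntideriv q g (q ^ n) ≤ 2 * q ^ N - q ^ n := by
  have hle (m : ℕ) : qAntideriv q g (q ^ m) ≤ q ^ m := by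
    simpa [abs_of_pos hq] using le_of_abs_le (abs_qAntideriv_le hq hq1 hg (q ^ m))
  rcases le_total n N with hn | hn
  · obtain ⟨m, rfl⟩ := Nat.exists_eq_add_of_le' hn
    rw [qAntideriv_eq_of_const hq hq1 hg (-1) (q ^ n) m fun k hk => by
      rw [← pow_add]; exact h _ (by lia)]
    rw [← pow_add]
    linarith [hle (m + n), pow_add q m n]
  · linarith [hle n, pow_le_pow_of_le_one hq.le hq1.le hn]

end qAntideriv

theorem qIntegrable_of_abs_le {q : ℝ} (hq : 0 < q) (hq1 : q < 1) {f : ℝ → ℝ}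
    (hf : ∀ t, |f t| ≤ |t|) : qIntegrable q 0 1 f := by
  refine (summable_geometric_of_lt_one hq.le hq1).of_norm_bounded fun k => ?_
  rw [zero_add, sub_zero, mul_one, Real.norm_eq_abs, abs_mul, abs_of_pos (pow_pos hq k)]
  refine mul_le_of_le_one_right (pow_pos hq k).le ((hf _).trans ?_)
  rw [abs_of_pos (pow_pos hq k)]
  exact pow_le_one₀ hq.le hq1.le

theorem qIntegral_le_of_le {q : ℝ} (hq : 0 < q) (hq1 : q < 1) {f : ℝ → ℝ}
    (hf : qIntegrable q 0 1 f) {c : ℝ} (h : ∀ n : ℕ, f (q ^ n) ≤ c - q ^ n) :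
    qIntegral q 0 1 f ≤ c - 1 / (1 + q) := by
  have h1 : 0 < 1 - q := sub_pos.2 hq1
  have hs : HasSum (fun k : ℕ => q ^ k * (c - q ^ k))
      ((1 - q)⁻¹ * c - (1 - q ^ 2)⁻¹) := by
    have h2 := hasSum_geometric_of_lt_one (sq_nonneg q) (pow_lt_one₀ hq.le hq1 two_ne_zero)
    refine (((hasSum_geometric_of_lt_one hq.le hq1).mul_right c).sub h2).congr_fun fun k => ?_
    rw [← pow_mul, mul_comm 2 k, pow_mul]
    ring
  have hle : ∑' k : ℕ, q ^ k * f (0 + q ^ k * (1 - 0)) ≤ (1 - q)⁻¹ * c - (1 - q ^ 2)⁻¹ := by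
    refine hasSum_le (fun k => ?_) hf.hasSum hs
    rw [zero_add, sub_zero, mul_one]
    exact mul_le_mul_of_nonneg_left (h k) (pow_pos hq k).le
  calc qIntegral q 0 1 f
      ≤ (1 - q) * (1 - 0) * ((1 - q)⁻¹ * c - (1 - q ^ 2)⁻¹) :=
        mul_le_mul_of_nonneg_left hle (by linarith)
    _ = c - 1 / (1 + q) := by
        have h2 : 1 + q ≠ 0 := by positivity
        rw [show 1 - q ^ 2 = (1 - q) * (1 + q) by ring]
        field_simp
        ring

theorem pow_mul_ne_pow {q x : ℝ} (hq : 0 < q) (hq1 : q < 1) (hx1 : x < 1)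
    (hxq : ∀ n : ℕ, x ≠ q ^ n) (j k : ℕ) : q ^ j * x ≠ q ^ k := by
  intro h
  have hj : 0 < q ^ j := pow_pos hq j
  rcases le_total j k with hjk | hjk
  · obtain ⟨m, rfl⟩ := Nat.exists_eq_add_of_le hjk
    rw [pow_add] at h
    exact hxq m (mul_left_cancel₀ hj.ne' h)
  · have := pow_le_pow_of_le_one hq.le hq1.le hjk
    nlinarith

theorem exists_continuous_eq_one_eq_neg_one {X : Type*} [TopologicalSpace X] [NormalSpace X]
    {s t : Set X} (hs : IsClosed s) (ht : IsClosed t) (hd : Disjoint s t) :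
    ∃ g : X → ℝ, Continuous g ∧ (∀ a, |g a| ≤ 1) ∧ (∀ a ∈ s, g a = 1) ∧ ∀ a ∈ t, g a = -1 := by
  obtain ⟨u, hu0, hu1, hu⟩ := exists_continuous_zero_one_of_isClosed hs ht hd
  refine ⟨fun a => 1 - 2 * u a, by fun_prop, fun a => ?_, fun a ha => ?_, fun a ha => ?_⟩
  · rw [abs_le]
    constructor <;> linarith [(hu a).1, (hu a).2]
  · simp [hu0 ha]
  · norm_num [hu1 ha]

/-- near-sharpness off the q-lattice with a q-derivative limit at `0⁺`. -/
theorem stmt_7 (q : ℝ) (hq : 0 < q) (hq1 : q < 1)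
    (x : ℝ) (hx : x ∈ Set.Ioo (0 : ℝ) 1) (hxq : ∀ n : ℕ, x ≠ q ^ n)
    (ε : ℝ) (hε : 0 < ε) :
    ∃ f : ℝ → ℝ, ContinuousOn f (Set.Icc 0 1) ∧ qIntegrable q 0 1 f ∧
      (∃ L : ℝ, Filter.Tendsto (qDeriv q 0 f) (nhdsWithin 0 (Set.Ioi 0)) (nhds L)) ∧
      (∀ t ∈ Set.Ioc (0 : ℝ) 1, |qDeriv q 0 f t| ≤ 1) ∧
      x + 1 / (1 + q) - ε ≤ |f x - qIntegral q 0 1 f| := by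
  obtain ⟨hx0, hx1⟩ := hx
  obtain ⟨N, hN⟩ := exists_pow_lt_of_lt_one (show 0 < ε / 4 by positivity) hq1
  obtain ⟨g, hc, hg, hg1, hg2⟩ := exists_continuous_eq_one_eq_neg_one
    ((Set.finite_Iio N).image fun k => q ^ k * x).isClosed
    ((Set.finite_Iio N).image fun k => q ^ k).isClosed (by
      rw [Set.disjoint_left]
      rintro _ ⟨j, -, rfl⟩ ⟨k, -, h⟩
      exact pow_mul_ne_pow hq hq1 hx1 hxq j k h.symm)
  have hint := qIntegrable_of_abs_le hq hq1 (abs_qAntideriv_le hq hq1 hg)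
  refine ⟨qAntideriv q g, (continuous_qAntideriv hq hq1 hc hg).continuousOn, hint,
    ⟨g 0, (hc.tendsto 0).mono_left nhdsWithin_le_nhds |>.congr' ?_⟩, fun t ht => ?_, ?_⟩
  · filter_upwards [self_mem_nhdsWithin] with t ht
    exact (qDeriv_qAntideriv hq hq1 hg (ne_of_gt ht)).symm
  · rw [qDeriv_qAntideriv hq hq1 hg ht.1.ne']
    exact hg t
  · have hlow := le_qAntideriv_of_eq_one hq hq1 hg hx0.le N
      fun k hk => hg1 _ (Set.mem_image_of_mem _ hk)
    have hup := qIntegral_le_of_le hq hq1 hint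
      (qAntideriv_pow_le hq hq1 hg N fun k hk => hg2 _ (Set.mem_image_of_mem _ hk))
    have hNx : q ^ N * x ≤ q ^ N := mul_le_of_le_one_right (pow_pos hq N).le hx1.le
    refine le_trans ?_ (le_abs_self _)
    linarith
end

section
/- Let 0<q<1, a<b be real numbers, and f:[a,b]→ℝ a q-integrable function over [a,b]. Then |f(b) − (1/(b−a))·∫_a^b f(t) d_q^a t| ≤ (q(b−a)/(1+q))·‖D_q^a f‖_∞^{(a,b]}. -/
open Set

/-- A bound on the shifted q-derivative controls the increments of `f` along the q-lattice. -/
theorem abs_sub_qLattice_le {q a b M : ℝ} {f : ℝ → ℝ} (hq : 0 < q) (hq1 : q < 1) (hab : a < b)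
    (hM : ∀ t ∈ Set.Ioc a b, |qDeriv q a f t| ≤ M) (k : ℕ) :
    |f b - f (a + q ^ k * (b - a))| ≤ M * (b - a) * (1 - q ^ k) := by
  induction k with
  | zero => simp
  | succ k ih =>
    have hL : 0 < b - a := sub_pos.2 hab
    have hqk : 0 < q ^ k := pow_pos hq k
    have hqk1 : q ^ k ≤ 1 := pow_le_one₀ hq.le hq1.le
    have hd : 0 < (1 - q) * (q ^ k * (b - a)) :=
      mul_pos (sub_pos.2 hq1) (mul_pos hqk hL)
    have h := hM (a + q ^ k * (b - a)) ⟨by nlinarith, by nlinarith⟩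
    have hx : a + q * (q ^ k * (b - a)) = a + q ^ (k + 1) * (b - a) := by ring
    rw [qDeriv, add_sub_cancel_left, abs_div, abs_of_pos hd, div_le_iff₀ hd, hx] at h
    calc
      _ ≤ _ := abs_sub_le (f b) (f (a + q ^ k * (b - a))) (f (a + q ^ (k + 1) * (b - a)))
      _ ≤ _ := add_le_add ih h
      _ = M * (b - a) * (1 - q ^ (k + 1)) := by ring

/-- q-Ostrowski inequality at the right endpoint. -/
theorem stmt_8 (q a b : ℝ) (hq : 0 < q) (hq1 : q < 1) (hab : a < b)
    (f : ℝ → ℝ) (hf : qIntegrable q a b f)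
    (M : ℝ) (hM : ∀ t ∈ Set.Ioc a b, |qDeriv q a f t| ≤ M) :
    |f b - (1 / (b - a)) * qIntegral q a b f| ≤ (q * (b - a) / (1 + q)) * M := by
  have hL : b - a ≠ 0 := (sub_pos.2 hab).ne'
  have h1 : 1 - q ≠ 0 := (sub_pos.2 hq1).ne'
  have h2 : 1 + q ≠ 0 := by positivity
  have hgeom := hasSum_geometric_of_lt_one hq.le hq1
  have hgeom2 := hasSum_geometric_of_lt_one (sq_nonneg q) (by nlinarith : q ^ 2 < 1)
  have hdiff := ((hgeom.mul_right (f b)).sub hf.hasSum).mul_left (1 - q)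
  have hbound := (hgeom.sub hgeom2).mul_left ((1 - q) * (M * (b - a)))
  have hle := tsum_of_norm_bounded hbound fun k => by
    change ‖(1 - q) * (q ^ k * f b - q ^ k * f (a + q ^ k * (b - a)))‖ ≤ _
    rw [← mul_sub, Real.norm_eq_abs, abs_mul, abs_mul, abs_of_pos (sub_pos.2 hq1),
      abs_of_pos (pow_pos hq k)]
    calc
      _ ≤ (1 - q) * (q ^ k * (M * (b - a) * (1 - q ^ k))) := by
        have := abs_sub_qLattice_le hq hq1 hab hM k
        have := (sub_pos.2 hq1).le
        gcongr
      _ = _ := by ring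
  rw [hdiff.tsum_eq, Real.norm_eq_abs] at hle
  convert hle using 1
  · congr 1
    rw [qIntegral]
    field_simp
  · rw [show 1 - q ^ 2 = (1 - q) * (1 + q) by ring]
    field_simp
    ring
end

section
/- For every fixed 0<q<1, the minimum over m∈ℕ∪{0} of the quantity (1 + 2q^{2m+1})/(1+q) − q^m is attained at m₀ = ⌊log_q(1/2)⌋; that is, for all m∈ℕ∪{0}, (1 + 2q^{2m₀+1})/(1+q) − q^{m₀} ≤ (1 + 2q^{2m+1})/(1+q) − q^m, where m₀ = ⌊(log(1/2))/(log q)⌋. -/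
open Set

/-- the minimizing lattice index is `⌊log_q (1/2)⌋`. -/
theorem stmt_10 (q : ℝ) (hq : 0 < q) (hq1 : q < 1)
    (m₀ : ℕ) (hm₀ : (m₀ : ℝ) = ⌊Real.log (1 / 2) / Real.log q⌋) :
    ∀ m : ℕ,
      (1 + 2 * q ^ (2 * m₀ + 1)) / (1 + q) - q ^ m₀ ≤
        (1 + 2 * q ^ (2 * m + 1)) / (1 + q) - q ^ m := by
  have hlog : Real.log q < 0 := Real.log_neg hq hq1
  have hy : 0 < q ^ m₀ := pow_pos hq _
  have hlower : 1 / 2 ≤ q ^ m₀ := by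
    have h : (m₀ : ℝ) ≤ Real.log (1 / 2) / Real.log q := hm₀ ▸ Int.floor_le _
    rw [le_div_iff_of_neg hlog, ← Real.log_pow] at h
    exact (Real.log_le_log_iff (by norm_num) hy).1 h
  have hupper : q * q ^ m₀ ≤ 1 / 2 := by
    have h : Real.log (1 / 2) / Real.log q < (m₀ : ℝ) + 1 := hm₀ ▸ Int.lt_floor_add_one _
    rw [div_lt_iff_of_neg hlog, ← Nat.cast_succ, ← Real.log_pow, Nat.succ_eq_add_one,
      pow_succ'] at h
    exact ((Real.log_lt_log_iff (by positivity) (by norm_num)).1 h).le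
  intro m
  have hx : 0 < q ^ m := pow_pos hq _
  have hdiff : (1 + 2 * q ^ (2 * m + 1)) / (1 + q) - q ^ m
      - ((1 + 2 * q ^ (2 * m₀ + 1)) / (1 + q) - q ^ m₀)
      = (q ^ m - q ^ m₀) * (2 * (q * (q ^ m + q ^ m₀)) - (1 + q)) / (1 + q) := by
    field_simp
    ring
  rw [← sub_nonneg, hdiff]
  refine div_nonneg ?_ (by positivity)
  rcases lt_trichotomy m m₀ with h | rfl | h
  · have hle : q ^ m₀ ≤ q * q ^ m := by
      rw [← pow_succ']
      exact pow_le_pow_of_le_one hq.le hq1.le h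
    exact mul_nonneg (by nlinarith) (by nlinarith)
  · simp
  · have hle : q ^ m ≤ q * q ^ m₀ := by
      rw [← pow_succ']
      exact pow_le_pow_of_le_one hq.le hq1.le h
    exact mul_nonneg_of_nonpos_of_nonpos (by nlinarith) (by nlinarith)
end

section
/- (q-Ostrowski inequality) Let 0<q<1, a<b be real numbers, and f:[a,b]→ℝ a q-integrable function over [a,b] that is continuous at x=a. Then for all x∈[a,b], |f(x) − (1/(b−a))·∫_a^b f(t) d_q^a t| ≤ (b−a)·((x−a)/(b−a) + 1/(1+q))·‖D_q^a f‖_∞^{(a,b]}. -/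
open Set

theorem add_pow_mul_sub_mem_Icc {q a b x : ℝ} (hq : 0 < q) (hq1 : q < 1)
    (hx : x ∈ Set.Icc a b) (n : ℕ) : a + q ^ n * (x - a) ∈ Set.Icc a b := by
  have hxa : 0 ≤ x - a := sub_nonneg.2 hx.1
  have hpow : q ^ n ≤ 1 := pow_le_one₀ hq.le hq1.le
  constructor
  · have := mul_nonneg (pow_pos hq n).le hxa
    linarith
  · have := mul_le_of_le_one_left hxa hpow
    linarith [hx.2]

/-- A bound on the shifted q-derivative gives a Lipschitz bound along the q-orbit of `x`. -/
theorem abs_sub_le_of_qDeriv_bound {q a b M : ℝ} {f : ℝ → ℝ} (hq : 0 < q) (hq1 : q < 1)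
    (hM : ∀ t ∈ Set.Ioc a b, |qDeriv q a f t| ≤ M) {x : ℝ} (hx : x ∈ Set.Ioc a b) (n : ℕ) :
    |f x - f (a + q ^ n * (x - a))| ≤ M * (x - a) * (1 - q ^ n) := by
  have hxa : 0 < x - a := sub_pos.2 hx.1
  induction n with
  | zero => simp
  | succ n ih =>
    have hpos : 0 < q ^ n * (x - a) := mul_pos (pow_pos hq n) hxa
    have h := hM (a + q ^ n * (x - a)) ⟨by linarith,
      (add_pow_mul_sub_mem_Icc hq hq1 (Set.Ioc_subset_Icc_self hx) n).2⟩
    have hden : 0 < (1 - q) * (q ^ n * (x - a)) := mul_pos (sub_pos.2 hq1) hpos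
    rw [qDeriv, add_sub_cancel_left, abs_div, abs_of_pos hden, div_le_iff₀ hden,
      ← mul_assoc q, ← pow_succ'] at h
    calc |f x - f (a + q ^ (n + 1) * (x - a))|
        ≤ |f x - f (a + q ^ n * (x - a))|
          + |f (a + q ^ n * (x - a)) - f (a + q ^ (n + 1) * (x - a))| := abs_sub_le _ _ _
      _ ≤ M * (x - a) * (1 - q ^ n) + M * ((1 - q) * (q ^ n * (x - a))) := add_le_add ih h
      _ = M * (x - a) * (1 - q ^ (n + 1)) := by ring

/-- A bound on the shifted q-derivative, with continuity at the base point, gives a Lipschitz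
bound at the base point. -/
theorem abs_sub_base_le_of_qDeriv_bound {q a b M : ℝ} {f : ℝ → ℝ} (hq : 0 < q) (hq1 : q < 1)
    (hcont : ContinuousWithinAt f (Set.Icc a b) a)
    (hM : ∀ t ∈ Set.Ioc a b, |qDeriv q a f t| ≤ M) {x : ℝ} (hx : x ∈ Set.Icc a b) :
    |f x - f a| ≤ M * (x - a) := by
  rcases hx.1.eq_or_lt with rfl | hax
  · simp
  have hpow := tendsto_pow_atTop_nhds_zero_of_lt_one hq.le hq1
  have harg : Filter.Tendsto (fun n : ℕ => a + q ^ n * (x - a)) Filter.atTop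
      (nhdsWithin a (Set.Icc a b)) := by
    refine tendsto_nhdsWithin_iff.2 ⟨?_, .of_forall (add_pow_mul_sub_mem_Icc hq hq1 hx)⟩
    simpa using (hpow.mul_const (x - a)).const_add a
  have hlim := ((hcont.tendsto.comp harg).const_sub (f x)).abs
  have hbound := (hpow.const_sub 1).const_mul (M * (x - a))
  rw [sub_zero, mul_one] at hbound
  exact le_of_tendsto_of_tendsto' hlim hbound
    (abs_sub_le_of_qDeriv_bound hq hq1 hM ⟨hax, hx.2⟩)

/-- The q-mean of `f` over `[a,b]` is close to the value at the base point. -/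
theorem abs_base_sub_qMean_le {q a b M : ℝ} {f : ℝ → ℝ} (hq : 0 < q) (hq1 : q < 1)
    (hab : a < b) (hf : qIntegrable q a b f) (hcont : ContinuousWithinAt f (Set.Icc a b) a)
    (hM : ∀ t ∈ Set.Ioc a b, |qDeriv q a f t| ≤ M) :
    |f a - (1 / (b - a)) * qIntegral q a b f| ≤ M * (b - a) * (1 / (1 + q)) := by
  have hba : b - a ≠ 0 := (sub_pos.2 hab).ne'
  have hq' : 0 < 1 - q := sub_pos.2 hq1
  have hgeom : HasSum (fun k : ℕ => q ^ k * f a) ((1 - q)⁻¹ * f a) :=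
    (hasSum_geometric_of_lt_one hq.le hq1).mul_right _
  have hdiff := hgeom.sub (Summable.hasSum hf)
  have hsq : HasSum (fun k : ℕ => M * (b - a) * (q ^ 2) ^ k) (M * (b - a) * (1 - q ^ 2)⁻¹) :=
    (hasSum_geometric_of_lt_one (sq_nonneg q) (by nlinarith)).mul_left _
  have hterm : ∀ k : ℕ, ‖q ^ k * f a - q ^ k * f (a + q ^ k * (b - a))‖ ≤
      M * (b - a) * (q ^ 2) ^ k := fun k => by
    have h := abs_sub_base_le_of_qDeriv_bound hq hq1 hcont hM
      (add_pow_mul_sub_mem_Icc hq hq1 (Set.right_mem_Icc.2 hab.le) k)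
    rw [add_sub_cancel_left, abs_sub_comm] at h
    rw [← mul_sub, Real.norm_eq_abs, abs_mul, abs_of_pos (pow_pos hq k)]
    calc q ^ k * |f a - f (a + q ^ k * (b - a))|
        ≤ q ^ k * (M * (q ^ k * (b - a))) := mul_le_mul_of_nonneg_left h (pow_pos hq k).le
      _ = M * (b - a) * (q ^ 2) ^ k := by ring
  have hle := hdiff.norm_le_of_bounded hsq hterm
  rw [Real.norm_eq_abs] at hle
  have heq : f a - (1 / (b - a)) * qIntegral q a b f = (1 - q) *
      ((1 - q)⁻¹ * f a - ∑' k : ℕ, q ^ k * f (a + q ^ k * (b - a))) := by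
    rw [qIntegral]
    field_simp
  rw [heq, abs_mul, abs_of_pos hq']
  refine (mul_le_mul_of_nonneg_left hle hq'.le).trans_eq ?_
  rw [show 1 - q ^ 2 = (1 - q) * (1 + q) by ring]
  field_simp

/-- q-Ostrowski inequality for all `x ∈ [a,b]`. -/
theorem stmt_12 (q a b : ℝ) (hq : 0 < q) (hq1 : q < 1) (hab : a < b)
    (f : ℝ → ℝ) (hf : qIntegrable q a b f)
    (hcont : ContinuousWithinAt f (Set.Icc a b) a)
    (M : ℝ) (hM : ∀ t ∈ Set.Ioc a b, |qDeriv q a f t| ≤ M) :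
    ∀ x ∈ Set.Icc a b,
      |f x - (1 / (b - a)) * qIntegral q a b f| ≤
        (b - a) * ((x - a) / (b - a) + 1 / (1 + q)) * M := by
  intro x hx
  have hba : b - a ≠ 0 := (sub_pos.2 hab).ne'
  calc |f x - (1 / (b - a)) * qIntegral q a b f|
      ≤ |f x - f a| + |f a - (1 / (b - a)) * qIntegral q a b f| := abs_sub_le _ _ _
    _ ≤ M * (x - a) + M * (b - a) * (1 / (1 + q)) :=
        add_le_add (abs_sub_base_le_of_qDeriv_bound hq hq1 hcont hM hx)
          (abs_base_sub_qMean_le hq hq1 hab hf hcont hM)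
    _ = (b - a) * ((x - a) / (b - a) + 1 / (1 + q)) * M := by
        rw [mul_add, mul_div_cancel₀ _ hba]
        ring
end

section
/- (Counterexample to the published q-Ostrowski inequality) Let q = 1/2 and define f:[0,1]→ℝ by f(t) = t for t∈[0,9/10] and f(t) = −9t + 9 for t∈[9/10,1]. Then f is q-integrable over [0,1] with ∫_0^1 f(t) d_q t = 1/6, sup_{t∈(0,1]} |D_q f(t)| = 1, and for x = 9/10 the inequality |f(x) − ∫_0^1 f(t) d_q t| ≤ ((1 + 2q·x²)/(1+q) − x)·sup_{t∈(0,1]}|D_q f(t)| fails, since |9/10 − 1/6| > 23/75. -/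
open Set

/-- The tent function with peak at `9 / 10`. -/
noncomputable def tent (t : ℝ) : ℝ := if t ≤ 9 / 10 then t else -9 * t + 9

theorem hasSum_tent :
    HasSum (fun k : ℕ => (1 / 2 : ℝ) ^ k * tent (0 + (1 / 2) ^ k * (1 - 0))) (1 / 3) := by
  have h_succ : ∀ k : ℕ, (1 / 2 : ℝ) ^ (k + 1) * tent (0 + (1 / 2) ^ (k + 1) * (1 - 0)) =
      1 / 4 * (1 / 4) ^ k := by
    intro k
    have h_le : (1 / 2 : ℝ) ^ k ≤ 1 := pow_le_one₀ (by norm_num) (by norm_num)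
    have h_sq : (1 / 4 : ℝ) ^ k = (1 / 2) ^ k * (1 / 2) ^ k := by
      rw [← mul_pow]; norm_num
    rw [tent, if_pos (by rw [pow_succ]; linarith), h_sq]
    ring
  rw [← hasSum_nat_add_iff' 1]
  simp only [h_succ]
  have h_geom := (hasSum_geometric_of_lt_one (r := (1 / 4 : ℝ)) (by norm_num)
    (by norm_num)).mul_left (1 / 4)
  have h_val : (1 / 3 : ℝ) - ∑ i ∈ Finset.range 1,
      (1 / 2 : ℝ) ^ i * tent (0 + (1 / 2) ^ i * (1 - 0)) = 1 / 4 * (1 - 1 / 4)⁻¹ := by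
    norm_num [tent]
  rwa [h_val]

theorem qIntegral_tent : qIntegral (1 / 2) 0 1 tent = 1 / 6 := by
  rw [qIntegral, hasSum_tent.tsum_eq]
  norm_num

theorem qDeriv_tent_of_le {t : ℝ} (ht₀ : 0 < t) (ht : t ≤ 9 / 10) :
    qDeriv (1 / 2) 0 tent t = 1 := by
  rw [qDeriv, tent, tent, if_pos ht, if_pos (by linarith)]
  rw [div_eq_one_iff_eq (by linarith)]
  ring

theorem abs_qDeriv_tent_le {t : ℝ} (ht : t ∈ Set.Ioc (0 : ℝ) 1) :
    |qDeriv (1 / 2) 0 tent t| ≤ 1 := by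
  obtain ⟨ht₀, ht₁⟩ := ht
  rcases le_or_gt t (9 / 10) with h | h
  · rw [qDeriv_tent_of_le ht₀ h, abs_one]
  · have h_pos : (0 : ℝ) < (1 - 1 / 2) * (t - 0) := by linarith
    rw [qDeriv, tent, tent, if_neg h.not_ge, if_pos (by linarith), abs_le,
      le_div_iff₀ h_pos, div_le_iff₀ h_pos]
    constructor <;> linarith

theorem isGreatest_abs_qDeriv_tent :
    IsGreatest ((fun t => |qDeriv (1 / 2) 0 tent t|) '' Set.Ioc 0 1) 1 := by
  refine ⟨⟨1 / 2, by norm_num, ?_⟩, ?_⟩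
  · simp only [qDeriv_tent_of_le (t := 1 / 2) (by norm_num) (by norm_num), abs_one]
  · rintro _ ⟨t, ht, rfl⟩
    exact abs_qDeriv_tent_le ht

/-- counterexample to the published q-Ostrowski inequality. -/
theorem stmt_14 (f : ℝ → ℝ)
    (hf : f = fun t => if t ≤ 9 / 10 then t else -9 * t + 9) :
    qIntegrable (1 / 2) 0 1 f ∧
    qIntegral (1 / 2) 0 1 f = 1 / 6 ∧
    sSup ((fun t => |qDeriv (1 / 2) 0 f t|) '' Set.Ioc 0 1) = 1 ∧
    ¬ |f (9 / 10) - qIntegral (1 / 2) 0 1 f| ≤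
        ((1 + 2 * (1 / 2) * (9 / 10 : ℝ) ^ 2) / (1 + 1 / 2) - 9 / 10) *
          sSup ((fun t => |qDeriv (1 / 2) 0 f t|) '' Set.Ioc 0 1) ∧
    (23 / 75 : ℝ) < |(9 / 10 : ℝ) - 1 / 6| := by
  obtain rfl : f = tent := hf
  rw [qIntegral_tent, isGreatest_abs_qDeriv_tent.csSup_eq]
  refine ⟨hasSum_tent.summable, rfl, rfl, ?_, ?_⟩
  · rw [not_le, tent, if_pos le_rfl, abs_of_pos (by norm_num)]
    norm_num
  · rw [abs_of_pos (by norm_num)]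
    norm_num
end

section
/- Let 0<q<1 and let c,d∈ℝ satisfy 0 < qc < qd < c < d ≤ 1. Let f:[0,1]→ℝ be a function such that f(αc + (1−α)d) = α·f(c) + (1−α)·f(d) and f(αqc + (1−α)qd) = α·f(qc) + (1−α)·f(qd) for all α∈[0,1]. Then for all t∈[c,d], min(D_q f(c), D_q f(d)) ≤ D_q f(t) ≤ max(D_q f(c), D_q f(d)). -/
open Set

/-- the q-derivative of a piecewise linear function lies between
its values at the endpoints. -/
theorem stmt_17 (q : ℝ) (hq : 0 < q) (hq1 : q < 1)
    (c d : ℝ) (h0 : 0 < q * c) (h1 : q * c < q * d) (h2 : q * d < c)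
    (h3 : c < d) (h4 : d ≤ 1)
    (f : ℝ → ℝ)
    (hlin : ∀ α ∈ Set.Icc (0 : ℝ) 1,
      f (α * c + (1 - α) * d) = α * f c + (1 - α) * f d)
    (hlinq : ∀ α ∈ Set.Icc (0 : ℝ) 1,
      f (α * (q * c) + (1 - α) * (q * d)) = α * f (q * c) + (1 - α) * f (q * d)) :
    ∀ t ∈ Set.Icc c d,
      min (qDeriv q 0 f c) (qDeriv q 0 f d) ≤ qDeriv q 0 f t ∧
      qDeriv q 0 f t ≤ max (qDeriv q 0 f c) (qDeriv q 0 f d) := by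
  intro t ht
  have hc : 0 < c := pos_of_mul_pos_right h0 hq.le
  have hd : 0 < d := hc.trans h3
  have ht0 : 0 < t := hc.trans_le ht.1
  have hq' : 0 < 1 - q := sub_pos.mpr hq1
  have key : ∀ x, 0 < x → qDeriv q 0 f x * ((1 - q) * x) = f x - f (q * x) := by
    intro x hx
    have hne : (1 - q) * x ≠ 0 := (mul_pos hq' hx).ne'
    simp only [qDeriv, sub_zero, zero_add]
    exact div_mul_cancel₀ _ hne
  obtain ⟨α, β, hα, hβ, hαβ, rfl⟩ : t ∈ segment ℝ c d := by
    rwa [segment_eq_Icc h3.le]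
  obtain rfl : β = 1 - α := by linarith
  simp only [smul_eq_mul] at ht0 ⊢
  have hmem : α ∈ Icc (0 : ℝ) 1 := ⟨hα, by linarith⟩
  have hf := hlin α hmem
  have hfq := hlinq α hmem
  rw [show α * (q * c) + (1 - α) * (q * d) = q * (α * c + (1 - α) * d) by ring] at hfq
  have hkt := key _ ht0
  rw [hf, hfq] at hkt
  have havg : qDeriv q 0 f (α * c + (1 - α) * d) * (α * c + (1 - α) * d)
      = α * c * qDeriv q 0 f c + (1 - α) * d * qDeriv q 0 f d := by
    apply mul_left_cancel₀ hq'.ne'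
    linear_combination hkt - α * key c hc - (1 - α) * key d hd
  have hαc : 0 ≤ α * c := mul_nonneg hα hc.le
  have hβd : 0 ≤ (1 - α) * d := mul_nonneg hβ hd.le
  constructor <;> refine le_of_mul_le_mul_right ?_ ht0 <;> rw [havg]
  · linarith [mul_le_mul_of_nonneg_left (min_le_left (qDeriv q 0 f c) (qDeriv q 0 f d)) hαc,
      mul_le_mul_of_nonneg_left (min_le_right (qDeriv q 0 f c) (qDeriv q 0 f d)) hβd]
  · linarith [mul_le_mul_of_nonneg_left (le_max_left (qDeriv q 0 f c) (qDeriv q 0 f d)) hαc,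
      mul_le_mul_of_nonneg_left (le_max_right (qDeriv q 0 f c) (qDeriv q 0 f d)) hβd]
end

section
/- (Sharpness of the q-Ostrowski inequality off the q-lattice) For every 0<q<1 and every x∈(0,1) that is not of the form qⁿ for any n∈ℕ∪{0}, there exists a continuous function f:[0,1]→ℝ that is q-integrable over [0,1], satisfies sup_{t∈(0,1]} |D_q f(t)| ≤ 1, and attains the bound: |f(x) − ∫_0^1 f(t) d_q t| = x + 1/(1+q). -/
open Set

/-- A continuous function with values in `[-1, 1]`, invariant under `t ↦ q * t` on the positive
reals, equal to `-1` at the powers of `q` and equal to `1` where `sin² (π log_q t) ≥ c`. -/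
noncomputable def logPeriodic (q c t : ℝ) : ℝ :=
  -1 + 2 * min 1 (Real.sin (Real.log t / Real.log q * Real.pi) ^ 2 / c)

lemma abs_logPeriodic_le_one {c : ℝ} (hc : 0 < c) (q t : ℝ) : |logPeriodic q c t| ≤ 1 := by
  have h1 := min_le_left (1 : ℝ) (Real.sin (Real.log t / Real.log q * Real.pi) ^ 2 / c)
  have h2 : 0 ≤ min (1 : ℝ) (Real.sin (Real.log t / Real.log q * Real.pi) ^ 2 / c) :=
    le_min zero_le_one (by positivity)
  rw [abs_le, logPeriodic]
  constructor <;> linarith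

lemma logPeriodic_mul_left {q : ℝ} (hq : 0 < q) (hq1 : q < 1) (c : ℝ) {t : ℝ} (ht : 0 < t) :
    logPeriodic q c (q * t) = logPeriodic q c t := by
  have hl : Real.log q ≠ 0 := (Real.log_neg hq hq1).ne
  have h : Real.log (q * t) / Real.log q * Real.pi
      = Real.log t / Real.log q * Real.pi + Real.pi := by
    rw [Real.log_mul hq.ne' ht.ne']
    field_simp
    ring
  rw [logPeriodic, logPeriodic, h, Real.sin_add_pi, neg_sq]

lemma logPeriodic_pow {q : ℝ} (hq : 0 < q) (hq1 : q < 1) (c : ℝ) (k : ℕ) :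
    logPeriodic q c (q ^ k) = -1 := by
  have hl : Real.log q ≠ 0 := (Real.log_neg hq hq1).ne
  rw [logPeriodic, Real.log_pow, mul_div_cancel_right₀ _ hl, Real.sin_nat_mul_pi]
  simp

lemma continuous_mul_logPeriodic {c : ℝ} (hc : 0 < c) (q : ℝ) :
    Continuous fun t => t * logPeriodic q c t := by
  rw [continuous_iff_continuousAt]
  intro t
  rcases eq_or_ne t 0 with rfl | ht
  · rw [ContinuousAt, zero_mul]
    refine squeeze_zero_norm (a := fun t : ℝ => |t|) (fun t => ?_) ?_
    · rw [Real.norm_eq_abs, abs_mul]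
      exact mul_le_of_le_one_right (abs_nonneg t) (abs_logPeriodic_le_one hc q t)
    · simpa using (continuous_abs (G := ℝ)).tendsto 0
  · unfold logPeriodic
    have h := Real.continuousAt_log ht
    fun_prop

lemma sin_log_div_log_ne_zero {q x : ℝ} (hq : 0 < q) (hq1 : q < 1) (hx : x ∈ Ioo (0 : ℝ) 1)
    (hxq : ∀ n : ℕ, x ≠ q ^ n) : Real.sin (Real.log x / Real.log q * Real.pi) ≠ 0 := by
  intro h
  have hl := Real.log_neg hq hq1
  obtain ⟨n, hn⟩ := Real.sin_eq_zero_iff.1 h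
  have hn' : (n : ℝ) = Real.log x / Real.log q := mul_right_cancel₀ Real.pi_ne_zero hn
  have hpos : (0 : ℝ) < n := hn' ▸ div_pos_of_neg_of_neg (Real.log_neg hx.1 hx.2) hl
  lift n to ℕ using by exact_mod_cast hpos.le
  refine hxq n (Real.log_injOn_pos hx.1 (pow_pos hq n) ?_)
  rw [Real.log_pow, ← Int.cast_natCast, hn', div_mul_cancel₀ _ hl.ne]

/-- sharpness of the q-Ostrowski inequality off the q-lattice. -/
theorem stmt_18 (q : ℝ) (hq : 0 < q) (hq1 : q < 1)
    (x : ℝ) (hx : x ∈ Set.Ioo (0 : ℝ) 1) (hxq : ∀ n : ℕ, x ≠ q ^ n) :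
    ∃ f : ℝ → ℝ, ContinuousOn f (Set.Icc 0 1) ∧ qIntegrable q 0 1 f ∧
      (∀ t ∈ Set.Ioc (0 : ℝ) 1, |qDeriv q 0 f t| ≤ 1) ∧
      |f x - qIntegral q 0 1 f| = x + 1 / (1 + q) := by
  set c := Real.sin (Real.log x / Real.log q * Real.pi) ^ 2 with hc_def
  have hc : 0 < c := by
    have := sin_log_div_log_ne_zero hq hq1 hx hxq
    positivity
  have hterm : (fun k : ℕ => q ^ k * ((0 + q ^ k * (1 - 0)) *
      logPeriodic q c (0 + q ^ k * (1 - 0)))) = fun k : ℕ => -(q ^ 2) ^ k := by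
    funext k
    rw [sub_zero, mul_one, zero_add, logPeriodic_pow hq hq1]
    ring
  have hq2 : q ^ 2 < 1 := pow_lt_one₀ hq.le hq1 two_ne_zero
  have hsum : HasSum (fun k : ℕ => -(q ^ 2) ^ k) (-(1 - q ^ 2)⁻¹) :=
    (hasSum_geometric_of_lt_one (sq_nonneg q) hq2).neg
  refine ⟨fun t => t * logPeriodic q c t, (continuous_mul_logPeriodic hc q).continuousOn,
    ?_, fun t ht => ?_, ?_⟩
  · rw [qIntegrable, hterm]
    exact hsum.summable
  · have h : qDeriv q 0 (fun t => t * logPeriodic q c t) t = logPeriodic q c t := by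
      have h1 : (1 - q) ≠ 0 := (sub_pos.2 hq1).ne'
      have h2 : t ≠ 0 := ht.1.ne'
      simp only [qDeriv, sub_zero, zero_add, logPeriodic_mul_left hq hq1 c ht.1]
      field_simp
    rw [h]
    exact abs_logPeriodic_le_one hc q t
  · beta_reduce
    have hfx : logPeriodic q c x = 1 := by
      rw [logPeriodic, ← hc_def, div_self hc.ne', min_self]
      norm_num
    have hI : qIntegral q 0 1 (fun t => t * logPeriodic q c t) = -(1 / (1 + q)) := by
      have h1 : (1 - q) ≠ 0 := (sub_pos.2 hq1).ne'
      have h2 : (1 + q) ≠ 0 := by positivity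
      rw [qIntegral, hterm, hsum.tsum_eq, show 1 - q ^ 2 = (1 - q) * (1 + q) by ring]
      field_simp
      ring
    rw [hI, hfx, mul_one, sub_neg_eq_add, abs_of_nonneg]
    have := hx.1
    positivity
end

section
/- (Unboundedness without a limit at the left endpoint) For every 0<q<1 and every C>0 there exists a function g:[0,1]→ℝ with g(0)=0, q-integrable over [0,1], such that |D_q g(t)| ≤ 1 for all t∈(0,1], but sup_{x∈(0,1]} |g(x) − ∫_0^1 g(t) d_q t| ≥ C; hence the q-Ostrowski bound (b−a)((x−a)/(b−a) + 1/(1+q))·‖D_q g‖_∞^{(0,1]} cannot hold for all x∈[0,1] without assuming that lim_{x→0+} g(x) exists. -/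
open Set

/-- The point `(1 + q) / 2` is not an integer power of `q`. -/
theorem midpoint_ne_zpow {q : ℝ} (hq : 0 < q) (hq1 : q < 1) (k : ℤ) : (1 + q) / 2 ≠ q ^ k := by
  intro h
  rcases le_or_gt k 0 with hk | hk
  · have := one_le_zpow_of_nonpos₀ hq hq1.le hk
    linarith
  · have := zpow_le_zpow_right_of_le_one₀ hq hq1.le (show (1 : ℤ) ≤ k by lia)
    rw [zpow_one] at this
    linarith

/-- The set of integer powers of `q` is invariant under multiplication by `q`. -/
theorem mul_mem_range_zpow_iff {q : ℝ} (hq : q ≠ 0) (t : ℝ) :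
    q * t ∈ range (fun k : ℤ => q ^ k) ↔ t ∈ range (fun k : ℤ => q ^ k) := by
  constructor
  · rintro ⟨k, hk⟩
    refine ⟨k - 1, mul_left_cancel₀ hq ?_⟩
    rw [← hk]
    simp only [zpow_sub_one₀ hq]
    field_simp
  · rintro ⟨k, rfl⟩
    exact ⟨k + 1, by simp only [zpow_add_one₀ hq, mul_comm]⟩

/-- without a limit at the left endpoint, the deviation from the
q-integral mean can be arbitrarily large even with bounded q-derivative. -/
theorem stmt_19 (q : ℝ) (hq : 0 < q) (hq1 : q < 1) (C : ℝ) (hC : 0 < C) :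
    ∃ g : ℝ → ℝ, g 0 = 0 ∧ qIntegrable q 0 1 g ∧
      (∀ t ∈ Set.Ioc (0 : ℝ) 1, |qDeriv q 0 g t| ≤ 1) ∧
      ∃ x ∈ Set.Ioc (0 : ℝ) 1, C ≤ |g x - qIntegral q 0 1 g| := by
  classical
  let g : ℝ → ℝ := fun x => if x = 0 ∨ x ∈ range (fun k : ℤ => q ^ k) then 0 else C
  have hg_pow (k : ℕ) : g (q ^ k) = 0 := if_pos (Or.inr ⟨k, zpow_natCast q k⟩)
  have hg_mul (t : ℝ) : g (q * t) = g t := by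
    simp only [g, mul_mem_range_zpow_iff hq.ne', mul_eq_zero, hq.ne', false_or]
  have hg_mid : g ((1 + q) / 2) = C := by
    refine if_neg ?_
    rintro (h | ⟨k, hk⟩)
    · linarith
    · exact midpoint_ne_zpow hq hq1 k hk.symm
  refine ⟨g, if_pos (Or.inl rfl), ?_, fun t _ => ?_, (1 + q) / 2, ⟨by linarith, by linarith⟩, ?_⟩
  · simp [qIntegrable, hg_pow, summable_zero]
  · simp [qDeriv, hg_mul]
  · simp [qIntegral, hg_pow, hg_mid, le_abs_self]
end
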